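/- Let A, B : K → K be linear maps on K = ℂⁿ such that the pair (A,B) has maximal rank. Let Q be the operator on K ⊕ K given by Q(χ₁,χ₂) := (χ₂, 0), let M := {(χ₁,χ₂) ∈ K ⊕ K : Aχ₁ + Bχ₂ = 0}, and let P_M be the orthogonal projection of K ⊕ K onto M. Then Im(P_M Q P_M) is positive semidefinite if and only if Im(AB†) is negative semidefinite. -/

import Mathlib

open ContinuousLinearMap

local notation "⟪" x ", " y "⟫" => @inner ℂ _ _ x y

/-- `K n = ℂⁿ` with the standard (Euclidean) inner product. -/
abbrev K (n : ℕ) := EuclideanSpace ℂ (Fin n)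

open Complex in
theorem norm_sub_I_smul_sq_sub {E : Type*} [NormedAddCommGroup E] [InnerProductSpace ℂ E]
    (p q : E) : ‖p - I • q‖ ^ 2 - ‖p + I • q‖ ^ 2 = 4 * (⟪p, q⟫).im := by
  rw [@norm_sub_sq ℂ, @norm_add_sq ℂ, inner_smul_right]
  simp
  ring

section Adjoint

variable {E F : Type*} [NormedAddCommGroup E] [InnerProductSpace ℂ E] [CompleteSpace E]
  [NormedAddCommGroup F] [InnerProductSpace ℂ F] [CompleteSpace F]

theorem norm_adjoint_le_of_forall_add_eq_zero {C D : E →L[ℂ] F} (hD : Function.Surjective D)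
    (h : ∀ u v, C u + D v = 0 → ‖v‖ ≤ ‖u‖) (χ : F) : ‖adjoint C χ‖ ≤ ‖adjoint D χ‖ := by
  obtain ⟨v, hv⟩ := hD (-C (adjoint C χ))
  have hle := h (adjoint C χ) v (by rw [hv]; abel)
  have key : ⟪adjoint C χ, adjoint C χ⟫ = -⟪adjoint D χ, v⟫ := by
    rw [adjoint_inner_left, adjoint_inner_left, hv, inner_neg_right, neg_neg]
  have hsq : ‖adjoint C χ‖ ^ 2 ≤ ‖adjoint D χ‖ * ‖v‖ := by
    rw [@norm_sq_eq_re_inner ℂ, key, ← inner_neg_right, ← norm_neg v]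
    exact re_inner_le_norm _ _
  by_contra! hlt
  nlinarith [norm_nonneg (adjoint D χ), norm_nonneg v]

theorem norm_le_of_forall_norm_adjoint_le {C D : E →L[ℂ] F}
    (hD : Function.Surjective (adjoint D)) (h : ∀ χ, ‖adjoint C χ‖ ≤ ‖adjoint D χ‖)
    {u v : E} (huv : C u + D v = 0) : ‖v‖ ≤ ‖u‖ := by
  obtain ⟨χ, rfl⟩ := hD v
  have key : ⟪adjoint D χ, adjoint D χ⟫ = -⟪adjoint C χ, u⟫ := by
    rw [adjoint_inner_left, adjoint_inner_left, eq_neg_of_add_eq_zero_left huv, inner_neg_right,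
      neg_neg]
  have hsq : ‖adjoint D χ‖ ^ 2 ≤ ‖adjoint C χ‖ * ‖u‖ := by
    rw [@norm_sq_eq_re_inner ℂ, key, ← inner_neg_right, ← norm_neg u]
    exact re_inner_le_norm _ _
  by_contra! hlt
  nlinarith [norm_nonneg u, h χ]

theorem eq_zero_of_adjoint_apply_eq_zero {A B : E →L[ℂ] F}
    (hmax : Function.Surjective fun χ : E × E => A χ.1 + B χ.2) {χ : F}
    (hA : adjoint A χ = 0) (hB : adjoint B χ = 0) : χ = 0 := by
  obtain ⟨x, hx⟩ := hmax χ
  rw [← inner_self_eq_zero (𝕜 := ℂ)]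
  nth_rw 2 [← hx]
  rw [inner_add_right, ← adjoint_inner_left, ← adjoint_inner_left, hA, hB]
  simp

end Adjoint

section FiniteDimensional

open Complex

variable {E : Type*} [NormedAddCommGroup E] [InnerProductSpace ℂ E] [FiniteDimensional ℂ E]

theorem surjective_of_forall_apply_eq_zero {D : E →L[ℂ] E} (h : ∀ v, D v = 0 → v = 0) :
    Function.Surjective D :=
  (LinearMap.injective_iff_surjective (f := (D : E →ₗ[ℂ] E))).1
    ((injective_iff_map_eq_zero D).2 h)

/-- The form `Im ⟨a, b⟩` is nonnegative on the kernel of `(a, b) ↦ A a + B b` iff it is nonpositive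
on the orthogonal complement of that kernel, the range of `χ ↦ (A† χ, B† χ)`. -/
theorem forall_im_inner_nonneg_iff_forall_im_inner_adjoint_nonpos [CompleteSpace E]
    {A B : E →L[ℂ] E} (hmax : Function.Surjective fun χ : E × E => A χ.1 + B χ.2) :
    (∀ a b, A a + B b = 0 → 0 ≤ (⟪a, b⟫).im) ↔
      ∀ χ, (⟪adjoint A χ, adjoint B χ⟫).im ≤ 0 := by
  have hC (χ : E) : adjoint (A + I • B) χ = adjoint A χ - I • adjoint B χ := by
    simp [map_smulₛₗ, sub_eq_add_neg]
  have hD (χ : E) : adjoint (A - I • B) χ = adjoint A χ + I • adjoint B χ := by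
    simp [map_smulₛₗ]
  constructor
  · intro h χ
    have hle (u v : E) (huv : (A + I • B) u + (A - I • B) v = 0) : ‖v‖ ≤ ‖u‖ := by
      have hab := h (u + v) (I • (u - v)) (by
        rw [← huv]
        simp only [add_apply, sub_apply, smul_apply, map_add, map_sub, map_smul]
        module)
      have hid := norm_sub_I_smul_sq_sub (u + v) (I • (u - v))
      have hu : u + v - I • I • (u - v) = (2 : ℂ) • u := by
        rw [smul_smul, I_mul_I]; module
      have hv : u + v + I • I • (u - v) = (2 : ℂ) • v := by
        rw [smul_smul, I_mul_I]; module
      rw [hu, hv, norm_smul, norm_smul, mul_pow, mul_pow, RCLike.norm_ofNat] at hid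
      exact le_of_sq_le_sq (by linarith) (norm_nonneg u)
    have hsurj : Function.Surjective (A - I • B) :=
      surjective_of_forall_apply_eq_zero fun v hv => by simpa using hle 0 v (by simpa using hv)
    have hχ := norm_adjoint_le_of_forall_add_eq_zero hsurj hle χ
    rw [hC, hD] at hχ
    linarith [norm_sub_I_smul_sq_sub (adjoint A χ) (adjoint B χ),
      pow_le_pow_left₀ (norm_nonneg _) hχ 2]
  · intro h a b hab
    have hle (χ : E) : ‖adjoint (A + I • B) χ‖ ≤ ‖adjoint (A - I • B) χ‖ := by
      rw [hC, hD]
      exact le_of_sq_le_sq (by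
        linarith [h χ, norm_sub_I_smul_sq_sub (adjoint A χ) (adjoint B χ)]) (norm_nonneg _)
    have hsurj : Function.Surjective (adjoint (A - I • B)) := by
      refine surjective_of_forall_apply_eq_zero fun χ hχ => ?_
      have hχ' : adjoint (A + I • B) χ = 0 :=
        norm_le_zero_iff.1 ((hle χ).trans_eq (by rw [hχ, norm_zero]))
      rw [hD] at hχ
      rw [hC, sub_eq_zero] at hχ'
      have hB : adjoint B χ = 0 := by
        rw [hχ', ← two_smul ℂ, smul_smul] at hχ
        simpa using hχ
      exact eq_zero_of_adjoint_apply_eq_zero hmax (by rw [hχ', hB, smul_zero]) hB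
    have hnorm : ‖a + I • b‖ ≤ ‖a - I • b‖ := by
      refine norm_le_of_forall_norm_adjoint_le hsurj hle ?_
      have : (A + I • B) (a - I • b) + (A - I • B) (a + I • b) =
          (2 : ℂ) • (A a - (I * I) • B b) := by
        simp only [add_apply, sub_apply, smul_apply, map_add, map_sub, map_smul]
        module
      rw [this, I_mul_I, neg_one_smul, sub_neg_eq_add, hab, smul_zero]
    linarith [norm_sub_I_smul_sq_sub a b, pow_le_pow_left₀ (norm_nonneg _) hnorm 2]

end FiniteDimensional

theorem re_inner_im_part_apply {E : Type*} [NormedAddCommGroup E] [InnerProductSpace ℂ E]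
    [CompleteSpace E] (T : E →L[ℂ] E) (χ : E) :
    (⟪χ, (((2 * Complex.I)⁻¹ : ℂ) • (T - adjoint T)) χ⟫).re = (⟪χ, T χ⟫).im := by
  rw [smul_apply, sub_apply, inner_smul_right, inner_sub_right, adjoint_inner_right,
    ← inner_conj_symm (T χ) χ, Complex.sub_conj]
  rw [show (2 * Complex.I)⁻¹ * (((2 * (⟪χ, T χ⟫).im : ℝ) : ℂ) * Complex.I) =
      ((⟪χ, T χ⟫).im : ℂ) by push_cast; field_simp, Complex.ofReal_re]

/-- Let `(A,B)` have maximal rank, `Q(χ₁,χ₂) := (χ₂,0)` on `K ⊕ K`,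
`M := {(χ₁,χ₂) : Aχ₁ + Bχ₂ = 0}`, and let `P` be the orthogonal projection of
`K ⊕ K` onto `M` (characterized by: `P` maps into `M`, fixes `M`, and is
self-adjoint with respect to the direct-sum inner product). Then
`Im(P Q P) ≥ 0` iff `Im(AB†) ≤ 0`. Here the quadratic form of `Im(P Q P)` at
`x` is the imaginary part of `⟨x, PQPx⟩` in the direct-sum inner product. -/
theorem stmt_10 {n : ℕ} (A B : K n →L[ℂ] K n)
    (hmax : Function.Surjective fun χ : K n × K n => A χ.1 + B χ.2)
    (P : (K n × K n) →ₗ[ℂ] (K n × K n))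
    (hPmem : ∀ x : K n × K n, A (P x).1 + B (P x).2 = 0)
    (hPfix : ∀ x : K n × K n, A x.1 + B x.2 = 0 → P x = x)
    (hPsa : ∀ x y : K n × K n,
      ⟪(P x).1, y.1⟫ + ⟪(P x).2, y.2⟫ = ⟪x.1, (P y).1⟫ + ⟪x.2, (P y).2⟫) :
    (∀ x : K n × K n,
        0 ≤ (⟪x.1, (P ((P x).2, 0)).1⟫ + ⟪x.2, (P ((P x).2, 0)).2⟫).im) ↔
    (∀ χ : K n,
        (⟪χ, (((2 * Complex.I)⁻¹ : ℂ) •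
            (A ∘L adjoint B - adjoint (A ∘L adjoint B))) χ⟫).re ≤ 0) := by
  have hform (x : K n × K n) :
      ⟪x.1, (P ((P x).2, 0)).1⟫ + ⟪x.2, (P ((P x).2, 0)).2⟫ = ⟪(P x).1, (P x).2⟫ := by
    rw [← hPsa, inner_zero_right, add_zero]
  have hM : (∀ x : K n × K n, 0 ≤ (⟪(P x).1, (P x).2⟫).im) ↔
      ∀ a b, A a + B b = 0 → 0 ≤ (⟪a, b⟫).im := by
    refine ⟨fun h a b hab => ?_, fun h x => h _ _ (hPmem x)⟩
    simpa [hPfix (a, b) hab] using h (a, b)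
  simp_rw [hform, re_inner_im_part_apply, comp_apply, ← adjoint_inner_left A]
  exact hM.trans (forall_im_inner_nonneg_iff_forall_im_inner_adjoint_nonpos hmax)
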